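/- Let k ≥ 1, l > 3, and let F be a graph with vertex set partitioned into independent sets V_1,...,V_k, each of size l. Let G be the ordered graph constructed from F as in the multicolored-clique reduction. Then for every ordered homomorphism f from G to a proper ordered subgraph H of G, and for every i ∈ {1,...,2k+1}, we have f(p_i) = p_i. -/

import Mathlib

/-- An ordered homomorphism between ordered graphs: edge-preserving and monotone. -/
def IsOrderedHom {V W : Type*} [Preorder V] [Preorder W]
    (G : SimpleGraph V) (H : SimpleGraph W) (f : V → W) : Prop :=
  (∀ ⦃u v : V⦄, G.Adj u v → H.Adj (f u) (f v)) ∧ Monotone f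

/-- An ordered homomorphism from `G` into a subgraph `H` of `G`. -/
def IsOrderedHomTo {V : Type*} [Preorder V] (G : SimpleGraph V)
    (H : G.Subgraph) (f : V → V) : Prop :=
  (∀ ⦃u v : V⦄, G.Adj u v → H.Adj (f u) (f v)) ∧ Monotone f ∧ ∀ v, f v ∈ H.verts

/-- An ordered retraction of `G` onto a subgraph `H`: an ordered homomorphism
`G → H` that is the identity on the vertices of `H`. -/
def IsOrderedRetraction {V : Type*} [Preorder V] (G : SimpleGraph V)
    (H : G.Subgraph) (f : V → V) : Prop :=
  IsOrderedHomTo G H f ∧ ∀ v ∈ H.verts, f v = v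

/-- An ordered graph is an ordered core if it admits no ordered retraction onto a
proper ordered subgraph. -/
def IsOrderedCore {V : Type*} [Preorder V] (G : SimpleGraph V) : Prop :=
  ∀ H : G.Subgraph, H ≠ ⊤ → ∀ f : V → V, ¬ IsOrderedRetraction G H f

/-- The (0-indexed) edge list of the edge-collapsible ordered matching `M^C_j`,
defined inductively: `M^C_4` has vertices `0 < ⋯ < 7` and edges
`{0,5}, {1,7}, {2,4}, {3,6}`; `M^C_{j+1}` is obtained from `M^C_j` by inserting a new
vertex `w` (between `v_j` and `v_{j+1}` of `M^C_j` if `j+1` is odd, after the last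
vertex of `M^C_j` if `j+1` is even), a new vertex `v` before the first vertex, and
the edge `vw`. -/
def mcEdges : ℕ → List (ℕ × ℕ)
  | 0 => []
  | 1 => []
  | 2 => []
  | 3 => []
  | 4 => [(0, 5), (1, 7), (2, 4), (3, 6)]
  | (j + 1) =>
      let wpos : ℕ := if (j + 1) % 2 = 1 then j else 2 * j
      (0, wpos + 1) ::
        (mcEdges j).map (fun e =>
          ((if wpos ≤ e.1 then e.1 + 1 else e.1) + 1,
           (if wpos ≤ e.2 then e.2 + 1 else e.2) + 1))

/-- The ordered matching `M^C_i`, as an ordered graph on `Fin (2*i)`. -/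
def mcGraph (i : ℕ) : SimpleGraph (Fin (2 * i)) :=
  SimpleGraph.fromRel (fun u v => ((u : ℕ), (v : ℕ)) ∈ mcEdges i)

/-- A subgraph is a single edge: two vertices joined by one edge. -/
def IsSingleEdge {V : Type*} {G : SimpleGraph V} (H : G.Subgraph) : Prop :=
  ∃ a b : V, a ≠ b ∧ H.verts = {a, b} ∧
    ∀ u v : V, H.Adj u v ↔ (u = a ∧ v = b) ∨ (u = b ∧ v = a)

/-- Position of the vertex `p_{t+1}` (0-indexed `t ∈ [0, 2k]`) in the reduction graph. -/
def pVert (N t : ℕ) : ℕ := t * (N + 1)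

/-- Position of the vertex `d^{i+1}_{j+1}` of `D_{i+1}` (0-indexed block `i < k`,
slot `j < N` where `N = l + k - 1`). -/
def dVert (N i j : ℕ) : ℕ := i * (N + 1) + 1 + j

/-- Position of the `(j+1)`-st vertex of `A_{i+1}` (0-indexed block `i < k`, slot
`j < N`); slots `j < l` are the vertices `v^{i+1}_{j+1}` of `C_{i+1}` and slots
`l ≤ j < N` are the vertices of `B_{i+1}` in their given order. -/
def aVert (k N i j : ℕ) : ℕ := (k + i) * (N + 1) + 1 + j

/-- The slot (0-indexed offset within `B_i`) of the vertex `w^{i+1}_{j+1}` of block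
`i` (the label list of `B_i` skips `i` itself). -/
def bSlot (i j : ℕ) : ℕ := if j < i then j else j - 1

/-- The `t`-th vertex (`t < 2N`) of the copy of the edge-collapsible matching `M^C_N`
placed on `D_{i+1}` followed by `A_{i+1}`. -/
def collVert (k N i t : ℕ) : ℕ := if t < N then dVert N i t else aVert k N i (t - N)

/-- The edge relation (on vertex positions) of the ordered graph `G` constructed from
the multicolored-clique instance `F`: path edges, complete edges, original edges and
collapsible edges. -/
def redRel (k l : ℕ) (F : SimpleGraph (Fin k × Fin l)) (u v : ℕ) : Prop :=
  -- path edges: `p_i` and `p_{i+1}` joined to every vertex of `D_i`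
  (∃ i j : ℕ, i < k ∧ j < l + k - 1 ∧
    (u = pVert (l + k - 1) i ∨ u = pVert (l + k - 1) (i + 1)) ∧
    v = dVert (l + k - 1) i j) ∨
  -- path edges: `p_{k+i}` and `p_{k+i+1}` joined to every vertex of `C_i`
  (∃ i j : ℕ, i < k ∧ j < l ∧
    (u = pVert (l + k - 1) (k + i) ∨ u = pVert (l + k - 1) (k + i + 1)) ∧
    v = aVert k (l + k - 1) i j) ∨
  -- complete edges: `w^i_j` joined to `w^j_i` for `i ≠ j`
  (∃ i j : ℕ, i < k ∧ j < k ∧ i ≠ j ∧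
    u = aVert k (l + k - 1) i (l + bSlot i j) ∧
    v = aVert k (l + k - 1) j (l + bSlot j i)) ∨
  -- original edges: `v^{i₁}_{j₁}` joined to `v^{i₂}_{j₂}` for edges of `F`
  (∃ (i₁ i₂ : Fin k) (j₁ j₂ : Fin l), F.Adj (i₁, j₁) (i₂, j₂) ∧
    u = aVert k (l + k - 1) (i₁ : ℕ) (j₁ : ℕ) ∧
    v = aVert k (l + k - 1) (i₂ : ℕ) (j₂ : ℕ)) ∨
  -- collapsible edges: a copy of `M^C_{l+k-1}` on `D_i` followed by `A_i`
  (∃ i x y : ℕ, i < k ∧ (x, y) ∈ mcEdges (l + k - 1) ∧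
    u = collVert k (l + k - 1) i x ∧ v = collVert k (l + k - 1) i y)

/-- The ordered graph `G` of the multicolored-clique reduction, on the
`2k+1 + 2k(l+k-1)` vertices `p_1, D_1, p_2, D_2, …, p_k, D_k, p_{k+1}, A_1, p_{k+2},
A_2, …, p_{2k}, A_k, p_{2k+1}` (in this order). -/
def redGraph (k l : ℕ) (F : SimpleGraph (Fin k × Fin l)) :
    SimpleGraph (Fin (2 * k + 1 + 2 * k * (l + k - 1))) :=
  SimpleGraph.fromRel (fun u v => redRel k l F (u : ℕ) (v : ℕ))

/-- Every edge of `M^C_j` joins the left half of the vertices to the right half. -/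
theorem mcEdges_crossing (j : ℕ) :
    ∀ e ∈ mcEdges j, e.1 < j ∧ j ≤ e.2 ∧ e.2 < 2 * j := by
  induction j with
  | zero => simp [mcEdges]
  | succ j ih =>
    match j, ih with
    | 0, _ => simp [mcEdges]
    | 1, _ => simp [mcEdges]
    | 2, _ => simp [mcEdges]
    | 3, _ => simp [mcEdges]
    | j + 4, ih =>
      intro e he
      rw [mcEdges] at he
      · simp only [List.mem_cons, List.mem_map] at he
        rcases he with rfl | ⟨e, he, rfl⟩
        · dsimp only
          split_ifs <;> omega
        · have := ih e he
          dsimp only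
          split_ifs <;> omega
      all_goals omega

/-- The index of the block containing a position, in the partition of the vertices of the
reduction graph into the consecutive blocks `p_1, D_1, p_2, …, p_{k+1}, A_1, …, p_{2k+1}`. -/
def blockIndex (N u : ℕ) : ℕ := 2 * (u / (N + 1)) + if u % (N + 1) = 0 then 0 else 1

theorem blockIndex_pVert (N t : ℕ) : blockIndex N (pVert N t) = 2 * t := by
  simp [blockIndex, pVert]

theorem blockIndex_mul_add {N j : ℕ} (t : ℕ) (hj : j < N) :
    blockIndex N (t * (N + 1) + 1 + j) = 2 * t + 1 := by
  have hdiv : (t * (N + 1) + 1 + j) / (N + 1) = t := by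
    rw [add_assoc, mul_comm, Nat.mul_add_div (by omega), Nat.div_eq_of_lt (by omega), add_zero]
  have hmod : (t * (N + 1) + 1 + j) % (N + 1) = 1 + j := by
    rw [add_assoc, Nat.mul_add_mod_self_right, Nat.mod_eq_of_lt (by omega)]
  rw [blockIndex, hdiv, hmod, if_neg (by omega)]

theorem blockIndex_dVert {N j : ℕ} (i : ℕ) (hj : j < N) :
    blockIndex N (dVert N i j) = 2 * i + 1 :=
  blockIndex_mul_add i hj

theorem blockIndex_aVert {N j : ℕ} (k i : ℕ) (hj : j < N) :
    blockIndex N (aVert k N i j) = 2 * (k + i) + 1 :=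
  blockIndex_mul_add (k + i) hj

theorem blockIndex_mono (N : ℕ) : Monotone (blockIndex N) := by
  intro u v h
  have hdiv : u / (N + 1) ≤ v / (N + 1) := Nat.div_le_div_right h
  have hu := Nat.div_add_mod u (N + 1)
  have hv := Nat.div_add_mod v (N + 1)
  unfold blockIndex
  rcases hdiv.lt_or_eq with hlt | heq
  · split_ifs <;> omega
  · rw [heq] at hu ⊢
    split_ifs <;> omega

theorem eq_pVert_of_blockIndex {N u t : ℕ} (h : blockIndex N u = 2 * t) : u = pVert N t := by
  have hu := Nat.div_add_mod u (N + 1)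
  unfold blockIndex at h
  split_ifs at h with h0
  · have ht : u / (N + 1) = t := by omega
    rw [ht, h0] at hu
    rw [pVert, mul_comm]
    exact hu.symm
  · omega

theorem bSlot_lt {k i j : ℕ} (hi : i < k) (hj : j < k) (hij : i ≠ j) : bSlot i j < k - 1 := by
  unfold bSlot
  split_ifs <;> omega

/-- The blocks of the reduction graph are independent sets. -/
theorem blockIndex_ne_of_redRel {k l : ℕ} (hk : 1 ≤ k) {F : SimpleGraph (Fin k × Fin l)}
    (hind : ∀ (i : Fin k) (a b : Fin l), ¬ F.Adj (i, a) (i, b)) {u v : ℕ}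
    (h : redRel k l F u v) :
    blockIndex (l + k - 1) u ≠ blockIndex (l + k - 1) v := by
  rcases h with ⟨i, j, hi, hj, hu, rfl⟩ | ⟨i, j, hi, hj, hu, rfl⟩ |
    ⟨i, j, hi, hj, hij, rfl, rfl⟩ | ⟨i₁, i₂, j₁, j₂, hF, rfl, rfl⟩ |
    ⟨i, x, y, hi, hxy, rfl, rfl⟩
  · rcases hu with rfl | rfl <;> rw [blockIndex_pVert, blockIndex_dVert i hj] <;> omega
  · rcases hu with rfl | rfl <;> rw [blockIndex_pVert, blockIndex_aVert k i (by omega)] <;> omega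
  · have h₁ := bSlot_lt hi hj hij
    have h₂ := bSlot_lt hj hi hij.symm
    rw [blockIndex_aVert k i (by omega), blockIndex_aVert k j (by omega)]
    omega
  · have hne : (i₁ : ℕ) ≠ i₂ := fun h ↦ by
      obtain rfl := Fin.ext h
      exact hind _ _ _ hF
    rw [blockIndex_aVert k i₁ (by omega), blockIndex_aVert k i₂ (by omega)]
    omega
  · obtain ⟨hx, hy, hy'⟩ := mcEdges_crossing _ _ hxy
    dsimp only at hx hy hy'
    rw [collVert, collVert, if_pos hx, if_neg (by omega), blockIndex_dVert i hx,
      blockIndex_aVert k i (by omega)]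
    omega

theorem blockIndex_ne_of_adj {k l : ℕ} (hk : 1 ≤ k) {F : SimpleGraph (Fin k × Fin l)}
    (hind : ∀ (i : Fin k) (a b : Fin l), ¬ F.Adj (i, a) (i, b))
    {u v : Fin (2 * k + 1 + 2 * k * (l + k - 1))} (h : (redGraph k l F).Adj u v) :
    blockIndex (l + k - 1) u ≠ blockIndex (l + k - 1) v := by
  rw [redGraph, SimpleGraph.fromRel_adj] at h
  rcases h.2 with h | h
  · exact blockIndex_ne_of_redRel hk hind h
  · exact (blockIndex_ne_of_redRel hk hind h).symm

/-- A step of the path through `p_1, D_1, p_2, …, p_{k+1}, C_1, …, p_{2k+1}`. -/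
theorem redRel_pVert_succ {k l t : ℕ} (hl : 0 < l) (F : SimpleGraph (Fin k × Fin l))
    (ht : t < 2 * k) {u : ℕ}
    (hu : u = pVert (l + k - 1) t ∨ u = pVert (l + k - 1) (t + 1)) :
    redRel k l F u (pVert (l + k - 1) t + 1) := by
  rcases lt_or_ge t k with h | h
  · exact Or.inl ⟨t, 0, h, by omega, hu, rfl⟩
  · obtain ⟨i, rfl⟩ := Nat.exists_eq_add_of_le h
    exact Or.inr (Or.inl ⟨i, 0, by omega, hl, hu, rfl⟩)

theorem eq_two_mul_of_add_two_le_succ {b : ℕ → ℕ} {n : ℕ}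
    (hb : ∀ t < n, b t + 2 ≤ b (t + 1)) (hn : b n ≤ 2 * n) : ∀ t ≤ n, b t = 2 * t := by
  have hlow : ∀ t ≤ n, 2 * t ≤ b t := by
    intro t
    induction t with
    | zero => omega
    | succ t ih =>
      intro ht
      have := ih (by omega)
      have := hb t (by omega)
      omega
  have hupp : ∀ s ≤ n, b (n - s) + 2 * s ≤ 2 * n := by
    intro s
    induction s with
    | zero => intro _; simpa using hn
    | succ s ih =>
      intro hs
      have h₁ := ih (by omega)
      have h₂ := hb (n - (s + 1)) (by omega)
      rw [show n - (s + 1) + 1 = n - s by omega] at h₂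
      omega
  intro t ht
  have h₁ := hlow t ht
  have h₂ := hupp (n - t) (by omega)
  rw [show n - (n - t) = t by omega] at h₂
  omega

/-- In the multicolored-clique reduction graph `G` built from `F`,
every ordered homomorphism `f` from `G` to a proper ordered subgraph `H` of `G` fixes
each of the vertices `p_1, …, p_{2k+1}`. -/
theorem redGraph_hom_fixes_p (k l : ℕ) (hk : 1 ≤ k) (hl : 3 < l)
    (F : SimpleGraph (Fin k × Fin l))
    (hind : ∀ (i : Fin k) (a b : Fin l), ¬ F.Adj (i, a) (i, b))
    (H : (redGraph k l F).Subgraph) (hne : H ≠ ⊤)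
    (f : Fin (2 * k + 1 + 2 * k * (l + k - 1)) → Fin (2 * k + 1 + 2 * k * (l + k - 1)))
    (hf : IsOrderedHomTo (redGraph k l F) H f) :
    ∀ t : ℕ, t ≤ 2 * k →
      ∀ x : Fin (2 * k + 1 + 2 * k * (l + k - 1)),
        (x : ℕ) = pVert (l + k - 1) t → f x = x := by
  obtain ⟨hadj, hmono, -⟩ := hf
  have hcard : 2 * k + 1 + 2 * k * (l + k - 1) = pVert (l + k - 1) (2 * k) + 1 := by
    rw [pVert]; ring
  have hle : ∀ t, t ≤ 2 * k → pVert (l + k - 1) t ≤ pVert (l + k - 1) (2 * k) := fun t ht ↦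
    Nat.mul_le_mul_right _ ht
  have hsucc : ∀ t, pVert (l + k - 1) (t + 1) = pVert (l + k - 1) t + (l + k - 1) + 1 := fun t ↦ by
    rw [pVert, pVert]; ring
  have hlt : ∀ {u v : Fin (2 * k + 1 + 2 * k * (l + k - 1))}, (u : ℕ) < v →
      (redRel k l F u v ∨ redRel k l F v u) →
      blockIndex (l + k - 1) (f u) < blockIndex (l + k - 1) (f v) := by
    intro u v huv hrel
    have huv' : (redGraph k l F).Adj u v := by
      rw [redGraph, SimpleGraph.fromRel_adj]
      exact ⟨(Fin.lt_def.mpr huv).ne, hrel⟩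
    exact (blockIndex_mono (l + k - 1) (Fin.le_def.mp (hmono (Fin.lt_def.mpr huv).le))).lt_of_ne
      (blockIndex_ne_of_adj hk hind (hadj huv').adj_sub)
  let b : ℕ → ℕ := fun t ↦
    if h : t ≤ 2 * k then
      blockIndex (l + k - 1) (f ⟨pVert (l + k - 1) t, by have := hle t h; omega⟩)
    else 0
  have hb : ∀ t < 2 * k, b t + 2 ≤ b (t + 1) := by
    intro t ht
    have h₁ := hle (t + 1) ht
    have h₂ := hsucc t
    have h₃ := hlt (u := ⟨pVert (l + k - 1) t, by omega⟩) (v := ⟨pVert (l + k - 1) t + 1, by omega⟩)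
      (Nat.lt_succ_self _) (Or.inl (redRel_pVert_succ (by omega) F ht (Or.inl rfl)))
    have h₄ := hlt (u := ⟨pVert (l + k - 1) t + 1, by omega⟩)
      (v := ⟨pVert (l + k - 1) (t + 1), by omega⟩)
      (by dsimp only; omega) (Or.inr (redRel_pVert_succ (by omega) F ht (Or.inr rfl)))
    simp only [b, dif_pos ht.le, dif_pos (Nat.succ_le_of_lt ht)]
    omega
  have hn : b (2 * k) ≤ 2 * (2 * k) := by
    simp only [b, le_refl, dif_pos]
    rw [← blockIndex_pVert (l + k - 1) (2 * k)]
    exact blockIndex_mono (l + k - 1) (by omega)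
  intro t ht x hx
  have hbt := eq_two_mul_of_add_two_le_succ hb hn t ht
  simp only [b, dif_pos ht] at hbt
  simp only [← hx, Fin.eta] at hbt
  exact Fin.ext ((eq_pVert_of_blockIndex hbt).trans hx.symm)
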